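/- Let q, q' ∈ ℤ² \ {0} be linearly independent over ℝ, and let 0 < ρ ≤ 1/2, 0 < ρ' ≤ 1/2. Then |B(q; ρ) ∩ B(q'; ρ')| = 4ρρ' = |B(q; ρ)|·|B(q'; ρ')|, where B(q; ρ) := {u ∈ [0,1]² : ‖q·u‖ < ρ}, |·| denotes planar Lebesgue measure, ‖ξ‖ is the distance from ξ ∈ ℝ to the nearest integer, and q·u = q₁u₁ + q₂u₂. -/

import Mathlib

open MeasureTheory Set

/-- `nint ξ = min {|ξ - p| : p ∈ ℤ}`, the distance from `ξ` to the nearest integer. -/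
noncomputable def nint (ξ : ℝ) : ℝ := ⨅ p : ℤ, |ξ - (p : ℝ)|

/-- `B(q; ρ) = {u ∈ [0,1]² : ‖q·u‖ < ρ}`, the `ρ`-neighbourhood in the unit
torus of the resonant lines `{u : q·u ∈ ℤ}`. -/
def B2 (q : ℤ × ℤ) (ρ : ℝ) : Set (ℝ × ℝ) :=
  {u | u.1 ∈ Icc (0 : ℝ) 1 ∧ u.2 ∈ Icc (0 : ℝ) 1 ∧
    nint ((q.1 : ℝ) * u.1 + (q.2 : ℝ) * u.2) < ρ}

theorem nint_eq_norm (ξ : ℝ) : nint ξ = ‖(ξ : UnitAddCircle)‖ := by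
  rw [UnitAddCircle.norm_eq]
  refine le_antisymm (ciInf_le ⟨0, ?_⟩ (round ξ)) (le_ciInf fun p => round_le ξ p)
  rintro _ ⟨p, rfl⟩
  positivity

theorem UnitAddCircle.volume_ball {ρ : ℝ} (hρ : ρ ≤ 1 / 2) (x : UnitAddCircle) :
    volume (Metric.ball x ρ) = ENNReal.ofReal (2 * ρ) := by
  rw [← measure_congr AddCircle.closedBall_ae_eq_ball, AddCircle.volume_closedBall,
    min_eq_right (by linarith)]

/-- The character `x ↦ q₁x₁ + q₂x₂` of the two-dimensional torus. -/
noncomputable def torusChar (q : ℤ × ℤ) : UnitAddCircle × UnitAddCircle →+ UnitAddCircle :=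
  q.1 • AddMonoidHom.fst _ _ + q.2 • AddMonoidHom.snd _ _

theorem torusChar_apply (q : ℤ × ℤ) (x : UnitAddCircle × UnitAddCircle) :
    torusChar q x = q.1 • x.1 + q.2 • x.2 := rfl

theorem torusChar_coe (q : ℤ × ℤ) (u : ℝ × ℝ) :
    torusChar q ((u.1 : UnitAddCircle), (u.2 : UnitAddCircle)) =
      ((q.1 * u.1 + q.2 * u.2 : ℝ) : UnitAddCircle) := by
  rw [torusChar_apply, AddCircle.coe_add, ← zsmul_eq_mul, ← zsmul_eq_mul, AddCircle.coe_zsmul,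
    AddCircle.coe_zsmul]

theorem continuous_torusChar (q : ℤ × ℤ) : Continuous (torusChar q) :=
  (continuous_fst.zsmul q.1).add (continuous_snd.zsmul q.2)

/-- Two characters with nonzero determinant are jointly equidistributed. -/
theorem measurePreserving_torusChar_prod {q q' : ℤ × ℤ} (h : q.1 * q'.2 - q.2 * q'.1 ≠ 0) :
    MeasurePreserving ((torusChar q).prod (torusChar q')) := by
  have : (volume : Measure (UnitAddCircle × UnitAddCircle)).IsAddHaarMeasure :=
    Measure.prod.instIsAddHaarMeasure _ _
  refine AddMonoidHom.measurePreserving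
    ((continuous_torusChar q).prodMk (continuous_torusChar q')) ?_ rfl
  rintro ⟨a, b⟩
  obtain ⟨a, rfl⟩ := QuotientAddGroup.mk_surjective a
  obtain ⟨b, rfl⟩ := QuotientAddGroup.mk_surjective b
  have hD : (q.1 * q'.2 - q.2 * q'.1 : ℝ) ≠ 0 := mod_cast h
  set D : ℝ := q.1 * q'.2 - q.2 * q'.1 with hD_def
  let u : ℝ × ℝ := ((q'.2 * a - q.2 * b) / D, (q.1 * b - q'.1 * a) / D)
  have ha : q.1 * u.1 + q.2 * u.2 = a := by
    simp only [u]
    field_simp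
    rw [hD_def]
    ring
  have hb : q'.1 * u.1 + q'.2 * u.2 = b := by
    simp only [u]
    field_simp
    rw [hD_def]
    ring
  refine ⟨((u.1 : UnitAddCircle), (u.2 : UnitAddCircle)), ?_⟩
  rw [AddMonoidHom.prod_apply, torusChar_coe, torusChar_coe, ha, hb]

theorem volume_unitSquare_inter_preimage {S : Set (UnitAddCircle × UnitAddCircle)}
    (hS : MeasurableSet S) :
    volume ((Icc (0 : ℝ) 1 ×ˢ Icc (0 : ℝ) 1) ∩
      Prod.map ((↑) : ℝ → UnitAddCircle) ((↑) : ℝ → UnitAddCircle) ⁻¹' S) = volume S := by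
  have hmk := UnitAddCircle.measurePreserving_mk 0
  rw [zero_add, restrict_Ioc_eq_restrict_Icc] at hmk
  have hprod := hmk.prod hmk
  rw [Measure.prod_restrict] at hprod
  rw [Measure.volume_eq_prod UnitAddCircle UnitAddCircle,
    ← hprod.measure_preimage hS.nullMeasurableSet,
    Measure.restrict_apply (hprod.measurable hS), inter_comm, ← Measure.volume_eq_prod]

theorem B2_eq (q : ℤ × ℤ) (ρ : ℝ) :
    B2 q ρ = (Icc (0 : ℝ) 1 ×ˢ Icc (0 : ℝ) 1) ∩
      Prod.map ((↑) : ℝ → UnitAddCircle) ((↑) : ℝ → UnitAddCircle) ⁻¹'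
        (torusChar q ⁻¹' Metric.ball 0 ρ) := by
  ext u
  simp only [B2, mem_ofPred_eq, mem_inter_iff, mem_prod, mem_preimage, mem_ball_zero_iff,
    nint_eq_norm, ← torusChar_coe, and_assoc, Prod.map]

theorem measurableSet_torusChar_preimage_ball (q : ℤ × ℤ) (ρ : ℝ) :
    MeasurableSet (torusChar q ⁻¹' Metric.ball 0 ρ) :=
  (continuous_torusChar q).measurable measurableSet_ball

theorem measurePreserving_torusChar {q : ℤ × ℤ} (hq : q ≠ 0) :
    MeasurePreserving (torusChar q) := by
  have h : q.1 * q.1 - q.2 * -q.2 ≠ 0 := by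
    contrapose! hq
    exact Prod.ext (by simp; nlinarith [sq_nonneg q.1, sq_nonneg q.2])
      (by simp; nlinarith [sq_nonneg q.1, sq_nonneg q.2])
  have : IsProbabilityMeasure (volume : Measure UnitAddCircle) := ⟨UnitAddCircle.measure_univ⟩
  exact measurePreserving_fst.comp (measurePreserving_torusChar_prod (q' := (-q.2, q.1)) h)

theorem volume_B2 {q : ℤ × ℤ} (hq : q ≠ 0) {ρ : ℝ} (hρ : ρ ≤ 1 / 2) :
    volume (B2 q ρ) = ENNReal.ofReal (2 * ρ) := by
  rw [B2_eq, volume_unitSquare_inter_preimage (measurableSet_torusChar_preimage_ball q ρ),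
    (measurePreserving_torusChar hq).measure_preimage measurableSet_ball.nullMeasurableSet,
    UnitAddCircle.volume_ball hρ]

theorem volume_B2_inter {q q' : ℤ × ℤ} (h : q.1 * q'.2 - q.2 * q'.1 ≠ 0) {ρ ρ' : ℝ}
    (hρ : ρ ≤ 1 / 2) (hρ' : ρ' ≤ 1 / 2) :
    volume (B2 q ρ ∩ B2 q' ρ') = ENNReal.ofReal (2 * ρ) * ENNReal.ofReal (2 * ρ') := by
  have hpre : torusChar q ⁻¹' Metric.ball 0 ρ ∩ torusChar q' ⁻¹' Metric.ball 0 ρ' =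
      (torusChar q).prod (torusChar q') ⁻¹' (Metric.ball 0 ρ ×ˢ Metric.ball 0 ρ') := rfl
  rw [B2_eq, B2_eq, ← inter_inter_distrib_left, ← preimage_inter,
    volume_unitSquare_inter_preimage ((measurableSet_torusChar_preimage_ball q ρ).inter
      (measurableSet_torusChar_preimage_ball q' ρ')), hpre,
    (measurePreserving_torusChar_prod h).measure_preimage
      (measurableSet_ball.prod measurableSet_ball).nullMeasurableSet,
    Measure.volume_eq_prod, Measure.prod_prod, UnitAddCircle.volume_ball hρ,
    UnitAddCircle.volume_ball hρ']

theorem det_ne_zero_of_linearIndependent {q q' : ℤ × ℤ} (hq : q ≠ 0)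
    (hind : LinearIndependent ℝ
      ![(((q.1 : ℝ), (q.2 : ℝ)) : ℝ × ℝ), (((q'.1 : ℝ), (q'.2 : ℝ)) : ℝ × ℝ)]) :
    q.1 * q'.2 - q.2 * q'.1 ≠ 0 := by
  intro h
  have hD : (q.1 * q'.2 - q.2 * q'.1 : ℝ) = 0 := mod_cast h
  rw [LinearIndependent.pair_iff] at hind
  have h₁ := (hind q'.1 (-q.1) (by ext <;> simp <;> linarith)).2
  have h₂ := (hind q'.2 (-q.2) (by ext <;> simp <;> linarith)).2
  exact hq (Prod.ext (by simpa using h₁) (by simpa using h₂))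

/-- **Pairwise independence for linearly independent resonant vectors**: if
`q, q' ∈ ℤ² \ {0}` are linearly independent over `ℝ` and `0 < ρ, ρ' ≤ 1/2`,
then `|B(q;ρ) ∩ B(q';ρ')| = 4ρρ' = |B(q;ρ)|·|B(q';ρ')|`. -/
theorem volume_B2_inter_independent (q q' : ℤ × ℤ) (hq : q ≠ 0) (hq' : q' ≠ 0)
    (hind : LinearIndependent ℝ
      ![(((q.1 : ℝ), (q.2 : ℝ)) : ℝ × ℝ), (((q'.1 : ℝ), (q'.2 : ℝ)) : ℝ × ℝ)])
    (ρ ρ' : ℝ) (hρ : 0 < ρ) (hρ₂ : ρ ≤ 1 / 2) (hρ' : 0 < ρ') (hρ'₂ : ρ' ≤ 1 / 2) :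
    volume (B2 q ρ ∩ B2 q' ρ') = ENNReal.ofReal (4 * ρ * ρ') ∧
    ENNReal.ofReal (4 * ρ * ρ') = volume (B2 q ρ) * volume (B2 q' ρ') := by
  have hmul : ENNReal.ofReal (4 * ρ * ρ') = ENNReal.ofReal (2 * ρ) * ENNReal.ofReal (2 * ρ') := by
    rw [← ENNReal.ofReal_mul (by positivity)]
    ring_nf
  rw [hmul, volume_B2 hq hρ₂, volume_B2 hq' hρ'₂]
  exact ⟨volume_B2_inter (det_ne_zero_of_linearIndependent hq hind) hρ₂ hρ'₂, rfl⟩
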